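/- (Regularization parameter upper bound.) In the VPBoost setting, for every M ≥ 0 and every m ≥ M, the regularization parameter is uniformly bounded: λ_m ≤ max{ λ_M, γ_up · (1/2)·β·α_high² · (1 + ρ_small)/(1 - ρ_small) }. -/

import Mathlib

open scoped RealInnerProductSpace
open Filter

theorem ContDiff.gradient_one {F : Type*} [NormedAddCommGroup F] [InnerProductSpace ℝ F]
    [CompleteSpace F] {L : F → ℝ} (hL : ContDiff ℝ 2 L) : ContDiff ℝ 1 (gradient L) := by
  have h : ContDiff ℝ 1 (fderiv ℝ L) := hL.fderiv_right (by norm_num)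
  exact (InnerProductSpace.toDual ℝ F).symm.contDiff.comp h

/-- Descent lemma: a function with Hessian bounded by `β` lies below its quadratic upper model. -/
theorem le_quadratic_of_norm_fderiv_gradient_le {F : Type*} [NormedAddCommGroup F]
    [InnerProductSpace ℝ F] [CompleteSpace F] {L : F → ℝ} {β : ℝ} (hL : ContDiff ℝ 2 L)
    (hH : ∀ x, ‖fderiv ℝ (gradient L) x‖ ≤ β) (x h : F) :
    L (x + h) ≤ L x + ⟪gradient L x, h⟫ + β / 2 * ‖h‖ ^ 2 := by
  have hlip (y : F) : ‖gradient L y - gradient L x‖ ≤ β * ‖y - x‖ :=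
    convex_univ.norm_image_sub_le_of_norm_fderiv_le
      (fun z _ => (hL.gradient_one.differentiable one_ne_zero) z) (fun z _ => hH z)
      (Set.mem_univ x) (Set.mem_univ y)
  have hderiv (t : ℝ) : HasDerivAt
      (fun t : ℝ => L (x + t • h) - t * ⟪gradient L x, h⟫ - β / 2 * ‖h‖ ^ 2 * t ^ 2)
      (⟪gradient L (x + t • h), h⟫ - ⟪gradient L x, h⟫ - β * ‖h‖ ^ 2 * t) t := by
    have hLd : HasFDerivAt L _ (x + t • h) :=
      ((hL.differentiable two_ne_zero) (x + t • h)).hasGradientAt.hasFDerivAt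
    have hline : HasDerivAt (fun t : ℝ => x + t • h) h t := by
      simpa using ((hasDerivAt_id t).smul_const h).const_add x
    have hcomp := hLd.comp_hasDerivAt t hline
    have hlin := (hasDerivAt_id t).mul_const ⟪gradient L x, h⟫
    have hquad := (hasDerivAt_pow 2 t).const_mul (β / 2 * ‖h‖ ^ 2)
    refine ((hcomp.sub hlin).sub hquad).congr_deriv ?_
    simp only [InnerProductSpace.toDual_apply_apply]
    ring
  have hanti := antitoneOn_of_deriv_nonpos (convex_Icc (0 : ℝ) 1)
    (fun t _ => (hderiv t).continuousAt.continuousWithinAt)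
    (fun t _ => (hderiv t).differentiableAt.differentiableWithinAt)
    (fun t ht => by
      rw [interior_Icc] at ht
      rw [(hderiv t).deriv, ← inner_sub_left]
      have hcs := real_inner_le_norm (gradient L (x + t • h) - gradient L x) h
      have hgrad := hlip (x + t • h)
      rw [add_sub_cancel_left, norm_smul, Real.norm_of_nonneg ht.1.le] at hgrad
      nlinarith [mul_le_mul_of_nonneg_right hgrad (norm_nonneg h)])
  have hend := hanti (Set.left_mem_Icc.2 zero_le_one) (Set.right_mem_Icc.2 zero_le_one) zero_le_one
  simp only [one_smul, zero_smul, add_zero] at hend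
  linarith

/-- A positive semidefinite operator on a finite-dimensional space, shifted by a positive multiple
of the identity, is invertible. -/
theorem isUnit_add_smul_one_of_inner_nonneg {E : Type*} [NormedAddCommGroup E]
    [InnerProductSpace ℝ E] [FiniteDimensional ℝ E] {T : E →L[ℝ] E} {c : ℝ}
    (hT : ∀ v, 0 ≤ ⟪v, T v⟫) (hc : 0 < c) : IsUnit (T + c • (1 : E →L[ℝ] E)) := by
  have : CompleteSpace E := FiniteDimensional.complete ℝ E
  have hinj : Function.Injective (T + c • (1 : E →L[ℝ] E)) := by
    rw [injective_iff_map_eq_zero]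
    intro v hv
    have h0 : ⟪v, (T + c • (1 : E →L[ℝ] E)) v⟫ = 0 := by rw [hv, inner_zero_right]
    simp only [add_apply, smul_apply,
      one_apply_eq_self, inner_add_right, inner_smul_right,
      real_inner_self_eq_norm_sq] at h0
    have hsq : ‖v‖ ^ 2 = 0 := by nlinarith [hT v, sq_nonneg ‖v‖]
    simpa using hsq
  rw [ContinuousLinearMap.isUnit_iff_bijective]
  exact ⟨hinj, LinearMap.injective_iff_surjective.1 hinj⟩

/-- **Regularization parameter upper bound.** In the VPBoost setting, for
every `M` and every `m ≥ M`, the regularization parameter satisfies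
`λ_m ≤ max{λ_M, γ_up·(1/2)·β·α_high²·(1+ρ_small)/(1-ρ_small)}`. -/
theorem stmt17
    {F : Type*} [NormedAddCommGroup F] [InnerProductSpace ℝ F] [CompleteSpace F]
    (n : ℕ) (L : F → ℝ)
    (β ρa ρs γup lamLow αlow αhigh κa κc : ℝ)
    -- regularity of the loss functional
    (hL : ContDiff ℝ 2 L)
    (hbdd : BddBelow (Set.range L))
    (hβ : 0 < β)
    (hHsa : ∀ x u v : F,
      ⟪(fderiv ℝ (gradient L) x) u, v⟫ = ⟪u, (fderiv ℝ (gradient L) x) v⟫)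
    (hHpsd : ∀ x u : F, 0 ≤ ⟪u, (fderiv ℝ (gradient L) x) u⟫)
    (hHnorm : ∀ x : F, ‖fderiv ℝ (gradient L) x‖ ≤ β)
    -- fixed constants
    (hρa0 : 0 ≤ ρa) (hρas : ρa < ρs) (hρs1 : ρs < 1)
    (hγup : 1 < γup) (hlamLow : 0 < lamLow)
    (hαlow : 0 < αlow) (hαle : αlow ≤ αhigh)
    (hκa0 : 0 < κa) (hκa1 : κa ≤ 1) (hκc : 0 < κc)
    -- the iterates of the algorithm
    (f : ℕ → F) (lam : ℕ → ℝ) (A : ℕ → EuclideanSpace ℝ (Fin n) →L[ℝ] F)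
    (hlam0 : lamLow ≤ lam 0)
    -- derived quantities at stage m
    (g : ℕ → F) (hg : ∀ m, g m = gradient L (f m))
    (Hess : ℕ → F →L[ℝ] F) (hHess : ∀ m, Hess m = fderiv ℝ (gradient L) (f m))
    (gbar : ℕ → EuclideanSpace ℝ (Fin n))
    (hgbar : ∀ m, gbar m = ContinuousLinearMap.adjoint (A m) (g m))
    (Hred : ℕ → EuclideanSpace ℝ (Fin n) →L[ℝ] EuclideanSpace ℝ (Fin n))
    (hHred : ∀ m, Hred m = ContinuousLinearMap.adjoint (A m) ∘L Hess m ∘L A m)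
    (w : ℕ → EuclideanSpace ℝ (Fin n))
    (hw : ∀ m, w m = -((Ring.inverse (Hred m + lam m •
        (1 : EuclideanSpace ℝ (Fin n) →L[ℝ] EuclideanSpace ℝ (Fin n)))) (gbar m)))
    (step : ℕ → F) (hstep : ∀ m, step m = A m (w m))
    (Q : ℕ → F → ℝ)
    (hQ : ∀ m (x : F), Q m x = ⟪g m, x⟫ + (1 / 2) * ⟪x, (Hess m) x⟫)
    (ρ : ℕ → ℝ)
    (hρ : ∀ m, ρ m = (L (f m) - L (f m + step m)) / (Q m 0 - Q m (step m)))
    -- subspace regularity at every stage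
    (hAlow : ∀ m, αlow ≤ ‖A m‖) (hAhigh : ∀ m, ‖A m‖ ≤ αhigh)
    (halign : ∀ m, κa * ‖A m‖ * ‖g m‖ ≤ ‖gbar m‖)
    (hcurve : ∀ m, κc * ⟪g m, (Hess m) (g m)⟫ ≤ ⟪step m, (Hess m) (step m)⟫)
    -- update rules
    (hupd : ∀ m,
      (g m ≠ 0 →
        (ρa < ρ m → f (m + 1) = f m + step m) ∧
        (¬ ρa < ρ m → f (m + 1) = f m) ∧
        (ρ m < ρs → lam (m + 1) = γup * lam m) ∧
        (¬ ρ m < ρs → lam (m + 1) = lam m)) ∧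
      (g m = 0 → f (m + 1) = f m ∧ lam (m + 1) = lam m))
    : ∀ M m : ℕ, M ≤ m →
      lam m ≤ max (lam M) (γup * (1 / 2 * β * αhigh ^ 2) * ((1 + ρs) / (1 - ρs))) := by
  have hlam (m : ℕ) : 0 < lam m := by
    induction m with
    | zero => linarith
    | succ m ih =>
      by_cases hg0 : g m = 0
      · rwa [((hupd m).2 hg0).2]
      · obtain ⟨-, -, hup, hkeep⟩ := (hupd m).1 hg0
        by_cases hρm : ρ m < ρs
        · rw [hup hρm]; positivity
        · rwa [hkeep hρm]
  have hρs0 : 0 ≤ ρs := hρa0.trans hρas.le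
  have hden : 0 < 1 - ρs := sub_pos.2 hρs1
  have hsmall (m : ℕ) (hg0 : g m ≠ 0) (hρm : ρ m < ρs) :
      lam m ≤ 1 / 2 * β * αhigh ^ 2 * ((1 + ρs) / (1 - ρs)) := by
    have hred (v : EuclideanSpace ℝ (Fin n)) : ⟪v, Hred m v⟫ = ⟪A m v, Hess m (A m v)⟫ := by
      rw [hHred m]
      exact ContinuousLinearMap.adjoint_inner_right (A m) v (Hess m (A m v))
    have hpsd (v : EuclideanSpace ℝ (Fin n)) : 0 ≤ ⟪v, Hred m v⟫ := by
      rw [hred, hHess m]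
      exact hHpsd _ _
    have hunit := isUnit_add_smul_one_of_inner_nonneg hpsd (hlam m)
    have hsolve : (Hred m + lam m •
        (1 : EuclideanSpace ℝ (Fin n) →L[ℝ] EuclideanSpace ℝ (Fin n))) (w m) = -gbar m := by
      rw [hw m, map_neg, ← mul_apply_eq_comp, Ring.mul_inverse_cancel _ hunit,
        one_apply_eq_self]
    have hgbar0 : gbar m ≠ 0 := by
      have hA : 0 < ‖A m‖ := hαlow.trans_le (hAlow m)
      have hgm : 0 < ‖g m‖ := norm_pos_iff.2 hg0
      exact norm_pos_iff.1 (lt_of_lt_of_le (by positivity) (halign m))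
    have hw0 : 0 < ‖w m‖ ^ 2 := by
      have : w m ≠ 0 := by
        intro h
        rw [h, map_zero] at hsolve
        exact hgbar0 (neg_eq_zero.1 hsolve.symm)
      positivity
    have hinner : ⟪g m, step m⟫ = -(⟪w m, Hred m (w m)⟫ + lam m * ‖w m‖ ^ 2) := by
      have h := congrArg (fun v => ⟪w m, v⟫) hsolve
      simp only [add_apply, smul_apply,
        one_apply_eq_self, inner_add_right, inner_smul_right, inner_neg_right,
        real_inner_self_eq_norm_sq] at h
      rw [h, neg_neg, hgbar m, hstep m, ContinuousLinearMap.adjoint_inner_right, real_inner_comm]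
    have hmodel : Q m 0 - Q m (step m) = 1 / 2 * ⟪w m, Hred m (w m)⟫ + lam m * ‖w m‖ ^ 2 := by
      rw [hQ, hQ, hinner, hred, ← hstep m]
      simp only [inner_zero_right, map_zero]
      ring
    have hpos : 0 < Q m 0 - Q m (step m) := by
      rw [hmodel]
      have := mul_pos (hlam m) hw0
      linarith [hpsd (w m)]
    have hratio : L (f m) - L (f m + step m) < ρs * (Q m 0 - Q m (step m)) := by
      rwa [hρ m, div_lt_iff₀ hpos] at hρm
    have hdesc := le_quadratic_of_norm_fderiv_gradient_le hL hHnorm (f m) (step m)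
    rw [← hg m, hinner] at hdesc
    rw [hmodel] at hratio
    have hstep_norm : ‖step m‖ ^ 2 ≤ αhigh ^ 2 * ‖w m‖ ^ 2 := by
      rw [hstep m, ← mul_pow]
      gcongr
      exact (A m).le_of_opNorm_le (hAhigh m) (w m)
    have hβstep := mul_le_mul_of_nonneg_left hstep_norm (by positivity : 0 ≤ β / 2)
    have hcurv : 0 ≤ (1 - ρs / 2) * ⟪w m, Hred m (w m)⟫ :=
      mul_nonneg (by linarith) (hpsd (w m))
    have hscaled : (lam m * (1 - ρs)) * ‖w m‖ ^ 2 ≤ (1 / 2 * β * αhigh ^ 2) * ‖w m‖ ^ 2 := by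
      linarith
    have hbound := le_of_mul_le_mul_right hscaled hw0
    rw [← mul_div_assoc, le_div_iff₀ hden]
    refine hbound.trans (le_mul_of_one_le_right (by positivity) (by linarith))
  intro M m hMm
  induction m, hMm using Nat.le_induction with
  | base => exact le_max_left _ _
  | succ m _ ih =>
    by_cases hg0 : g m = 0
    · rwa [((hupd m).2 hg0).2]
    · obtain ⟨-, -, hup, hkeep⟩ := (hupd m).1 hg0
      by_cases hρm : ρ m < ρs
      · rw [hup hρm, mul_assoc γup]
        exact le_max_of_le_right
          (mul_le_mul_of_nonneg_left (hsmall m hg0 hρm) (by linarith))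
      · rwa [hkeep hρm]
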